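/- Realizations with endpoints on the bounding box: Every turn sequence σ with l − r ∈ {0, 1, −1, 2, −2} has a realization by a rectilinear chain C such that both the starting point o = (0,0) and the endpoint of C lie on the boundary of the smallest axis-parallel bounding box of C. Moreover, if l − r = 0, then there is a realization in which the last segment of the chain is entirely contained in one side of its smallest axis-parallel bounding box. -/

import Mathlib

/-- A turn: left (`L`) or right (`R`). -/
inductive Turn : Type
  | L : Turn
  | R : Turn
  deriving DecidableEq

/-- Rotation of a direction vector by 90° counterclockwise. -/
def rotCCW (d : ℤ × ℤ) : ℤ × ℤ := (-d.2, d.1)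

/-- Rotation of a direction vector by 90° clockwise. -/
def rotCW (d : ℤ × ℤ) : ℤ × ℤ := (d.2, -d.1)

/-- Unit direction of the axis-parallel segment from `u` to `v`. -/
def unitDir (u v : ℤ × ℤ) : ℤ × ℤ := ((v.1 - u.1).sign, (v.2 - u.2).sign)

/-- The set of integer points on the axis-parallel closed segment from `u` to `v`. -/
def segSet (u v : ℤ × ℤ) : Set (ℤ × ℤ) :=
  {q | min u.1 v.1 ≤ q.1 ∧ q.1 ≤ max u.1 v.1 ∧ min u.2 v.2 ≤ q.2 ∧ q.2 ≤ max u.2 v.2}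

/-- A simple rectilinear chain realizing the turn sequence `σ = σ₁⋯σₙ` (as a list,
`σ.get ⟨i, _⟩` is the `(i+1)`-st turn `σ_{i+1}`).  It consists of the points
`pts 0, …, pts (n+1)` with `pts 0 = (0,0)`; consecutive points span nondegenerate
axis-parallel segments, the first segment heads east, the chain turns left (CCW) or
right (CW) at each bend as prescribed by `σ`, and the chain is simple. -/
structure Chain (σ : List Turn) where
  pts : ℕ → ℤ × ℤ
  start_eq : pts 0 = (0, 0)
  first_seg : ∃ t : ℤ, 0 < t ∧ pts 1 = (t, 0)
  axis_parallel : ∀ i ≤ σ.length,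
    ((pts (i + 1)).1 = (pts i).1 ∧ (pts (i + 1)).2 ≠ (pts i).2) ∨
    ((pts (i + 1)).2 = (pts i).2 ∧ (pts (i + 1)).1 ≠ (pts i).1)
  turns : ∀ i, ∀ h : i < σ.length,
    unitDir (pts (i + 1)) (pts (i + 2)) =
      (if σ.get ⟨i, h⟩ = Turn.L then rotCCW else rotCW) (unitDir (pts i) (pts (i + 1)))
  simple_adj : ∀ i, i + 1 ≤ σ.length →
    segSet (pts i) (pts (i + 1)) ∩ segSet (pts (i + 1)) (pts (i + 2)) = {pts (i + 1)}
  simple_nonadj : ∀ i j, i + 1 < j → j ≤ σ.length →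
    segSet (pts i) (pts (i + 1)) ∩ segSet (pts j) (pts (j + 1)) = ∅

/-- `A(σ)`: the set of points reachable by the turn sequence `σ`. -/
def ReachSet (σ : List Turn) : Set (ℤ × ℤ) :=
  {q | ∃ C : Chain σ, C.pts (σ.length + 1) = q}

/-- The halfplane `V⁺(p)` (requires `p.1 ≠ 0` to be meaningful). -/
def Vplus (p : ℤ × ℤ) : Set (ℤ × ℤ) :=
  {q | ∃ i j : ℤ, 0 ≤ i ∧ q = (p.1 + p.1.sign * i, j)}

/-- The halfplane `H⁺(p)` (requires `p.2 ≠ 0` to be meaningful). -/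
def Hplus (p : ℤ × ℤ) : Set (ℤ × ℤ) :=
  {q | ∃ i j : ℤ, 0 ≤ j ∧ q = (i, p.2 + p.2.sign * j)}

/-- The quadrant `Q⁺(p)`. -/
def Qplus (p : ℤ × ℤ) : Set (ℤ × ℤ) := Vplus p ∩ Hplus p

/-- A staircase: consecutive turns always differ. -/
def IsStaircase (σ : List Turn) : Prop := σ.Chain' (· ≠ ·)

/-- The prefix number `δᵢ`: number of `L`s minus number of `R`s among the first `i` turns. -/
def delta (σ : List Turn) (i : ℕ) : ℤ :=
  ((σ.take i).count Turn.L : ℤ) - ((σ.take i).count Turn.R : ℤ)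

/-- The excess number `l - r` of a turn sequence. -/
def excess (σ : List Turn) : ℤ := (σ.count Turn.L : ℤ) - (σ.count Turn.R : ℤ)

/-- `σ` has a hook (two equal consecutive turns, at 1-based positions `k+1, k+2`)
whose prefix number is `≡ d (mod 4)`: `d = 0, 1, 2, 3` for right, up, left, down hooks. -/
def HasHook (σ : List Turn) (d : ℤ) : Prop :=
  ∃ k, ∃ h : k + 1 < σ.length,
    σ.get ⟨k, by omega⟩ = σ.get ⟨k + 1, h⟩ ∧ delta σ (k + 1) % 4 = d

/-- `σ` has some hook, i.e. two equal consecutive turns. -/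
def HasAnyHook (σ : List Turn) : Prop :=
  ∃ k, ∃ h : k + 1 < σ.length, σ.get ⟨k, by omega⟩ = σ.get ⟨k + 1, h⟩

/-- A set `S ⊆ ℤ²` is connected: any two points of `S` are joined by a path inside `S`
whose consecutive points are at `L¹`-distance `1`. -/
def GridConnected (S : Set (ℤ × ℤ)) : Prop :=
  ∀ p ∈ S, ∀ q ∈ S, ∃ (n : ℕ) (f : ℕ → ℤ × ℤ),
    f 0 = p ∧ f n = q ∧ (∀ i ≤ n, f i ∈ S) ∧
    ∀ i < n, |(f (i + 1)).1 - (f i).1| + |(f (i + 1)).2 - (f i).2| = 1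

/-- `q` lies on the boundary of the smallest axis-parallel bounding box of the chain `C`
(for `q` a point of the chain: it attains an extreme coordinate). -/
def OnBBoxBoundary (σ : List Turn) (C : Chain σ) (q : ℤ × ℤ) : Prop :=
  (∀ i ≤ σ.length + 1, q.1 ≤ (C.pts i).1) ∨ (∀ i ≤ σ.length + 1, (C.pts i).1 ≤ q.1) ∨
  (∀ i ≤ σ.length + 1, q.2 ≤ (C.pts i).2) ∨ (∀ i ≤ σ.length + 1, (C.pts i).2 ≤ q.2)

/-- The last segment of the chain `C` is entirely contained in one side of the smallest
axis-parallel bounding box of `C`. -/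
def LastSegOnSide (σ : List Turn) (C : Chain σ) : Prop :=
  ((C.pts σ.length).1 = (C.pts (σ.length + 1)).1 ∧
     ∀ i ≤ σ.length + 1, (C.pts σ.length).1 ≤ (C.pts i).1) ∨
  ((C.pts σ.length).1 = (C.pts (σ.length + 1)).1 ∧
     ∀ i ≤ σ.length + 1, (C.pts i).1 ≤ (C.pts σ.length).1) ∨
  ((C.pts σ.length).2 = (C.pts (σ.length + 1)).2 ∧
     ∀ i ≤ σ.length + 1, (C.pts σ.length).2 ≤ (C.pts i).2) ∨
  ((C.pts σ.length).2 = (C.pts (σ.length + 1)).2 ∧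
     ∀ i ≤ σ.length + 1, (C.pts i).2 ≤ (C.pts σ.length).2)

/-- The turn `σₘ` (1-based indexing). -/
def turnAt (σ : List Turn) (m : ℕ) : Turn := σ.getD (m - 1) Turn.L

/-- The suffix `σ_k ⋯ σ_n` contains no hook and all its prefix numbers `δᵢ`,
`k - 1 ≤ i ≤ n`, are `≡ 1` or `2 (mod 4)` (the combinatorial description of a
NW-staircase containing the endpoint). -/
def GoodSuffix (σ : List Turn) (k : ℕ) : Prop :=
  1 ≤ k ∧ k ≤ σ.length ∧
  (∀ m : ℕ, k ≤ m → m < σ.length → turnAt σ m ≠ turnAt σ (m + 1)) ∧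
  (∀ i : ℕ, k - 1 ≤ i → i ≤ σ.length → delta σ i % 4 = 1 ∨ delta σ i % 4 = 2)

open Classical in
/-- `₋ₓm₊ᵧᵖ(σ)`: taking the longest good suffix (i.e. the least `k` with
`GoodSuffix σ k`), the number of indices `i` with `k - 1 ≤ i ≤ n` and
`δᵢ ≡ 1 (mod 4)`; `0` if no good suffix exists. -/
noncomputable def mNWp (σ : List Turn) : ℕ :=
  if ∃ k, GoodSuffix σ k then
    Nat.card {i : ℕ // sInf {k | GoodSuffix σ k} - 1 ≤ i ∧ i ≤ σ.length ∧
      delta σ i % 4 = 1}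
  else 0

/-- The number of vertical segments of the chain `C` meeting the closed horizontal
segment from the origin to `(a, 0)`. -/
def verticalCrossCount (σ : List Turn) (C : Chain σ) (a : ℤ) : ℕ :=
  ((Finset.range (σ.length + 1)).filter fun i =>
    (C.pts i).1 = (C.pts (i + 1)).1 ∧
    0 ≤ (C.pts i).1 ∧ (C.pts i).1 ≤ a ∧
    min (C.pts i).2 (C.pts (i + 1)).2 ≤ 0 ∧ 0 ≤ max (C.pts i).2 (C.pts (i + 1)).2).card

/-- The unit direction of the `(i+1)`-st segment of the chain `C`. -/
def dirOf (σ : List Turn) (C : Chain σ) (i : ℕ) : ℤ × ℤ := unitDir (C.pts i) (C.pts (i + 1))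

/-- `z₁mz₂ᵒ(C)`: the number of `z₂`-segments in the maximal `(z₁,z₂)`-staircase subchain
of `C` containing the origin (the longest prefix of segments directed `z₁` or `z₂`);
`0` if no such subchain exists. -/
noncomputable def stairCountO (σ : List Turn) (C : Chain σ) (z₁ z₂ : ℤ × ℤ) : ℕ :=
  Nat.card {i : ℕ // i ≤ σ.length ∧ dirOf σ C i = z₂ ∧
    ∀ j ≤ i, dirOf σ C j = z₁ ∨ dirOf σ C j = z₂}

/-- `z₁mz₂ᵖ(C)`: the number of `z₂`-segments in the maximal `(z₁,z₂)`-staircase subchain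
of `C` containing the endpoint (the longest suffix of segments directed `z₁` or `z₂`);
`0` if no such subchain exists. -/
noncomputable def stairCountP (σ : List Turn) (C : Chain σ) (z₁ z₂ : ℤ × ℤ) : ℕ :=
  Nat.card {i : ℕ // i ≤ σ.length ∧ dirOf σ C i = z₂ ∧
    ∀ j, i ≤ j → j ≤ σ.length → dirOf σ C j = z₁ ∨ dirOf σ C j = z₂}

/-- The rotation of headings effected by a turn. -/
def Turn.rot : Turn → ℤ × ℤ → ℤ × ℤ
  | Turn.L => rotCCW
  | Turn.R => rotCW

theorem Turn.rot_eq_ite (c : Turn) (d : ℤ × ℤ) :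
    c.rot d = (if c = Turn.L then rotCCW else rotCW) d := by
  cases c <;> rfl

/-- The direction in which a chain starting eastwards moves after the turns `σ`. -/
def heading (σ : List Turn) : ℤ × ℤ := σ.foldl (fun d c => c.rot d) (1, 0)

/-- `d` is one of the four axis-parallel unit vectors. -/
def IsAxisUnit (d : ℤ × ℤ) : Prop := d = (1, 0) ∨ d = (0, 1) ∨ d = (-1, 0) ∨ d = (0, -1)

/-- `b` is reached from `a` by a positive move in direction `d`. -/
def IsStep (d a b : ℤ × ℤ) : Prop := ∃ t : ℤ, 0 < t ∧ b.1 = a.1 + t * d.1 ∧ b.2 = a.2 + t * d.2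

/-- The bounding boxes of `a, b` and of `c, d` are separated in one coordinate. -/
def Separated (a b c d : ℤ × ℤ) : Prop :=
  max a.1 b.1 < min c.1 d.1 ∨ max c.1 d.1 < min a.1 b.1 ∨
  max a.2 b.2 < min c.2 d.2 ∨ max c.2 d.2 < min a.2 b.2

/-- The coordinate of `q` in direction `d`. -/
def coordAlong (d q : ℤ × ℤ) : ℤ := d.1 * q.1 + d.2 * q.2

/-- The points `p 0, …, p (n + 1)` form a simple rectilinear chain with turns `σ`. -/
structure IsRealization (σ : List Turn) (p : ℕ → ℤ × ℤ) : Prop where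
  start_eq : p 0 = (0, 0)
  step : ∀ i ≤ σ.length, IsStep (heading (σ.take i)) (p i) (p (i + 1))
  sep : ∀ i j, i + 1 < j → j ≤ σ.length → Separated (p i) (p (i + 1)) (p j) (p (j + 1))

/-- A realization whose start is extreme to the west and whose endpoint is extreme in the
direction of the last segment, strictly so compared with the interior vertices. -/
structure IsExtremal (σ : List Turn) (p : ℕ → ℤ × ℤ) : Prop extends IsRealization σ p where
  inner_pos : ∀ i, 1 ≤ i → i ≤ σ.length → 0 < (p i).1
  end_nonneg : 0 ≤ (p (σ.length + 1)).1
  inner_lt : ∀ i, 1 ≤ i → i ≤ σ.length →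
    coordAlong (heading σ) (p i) < coordAlong (heading σ) (p (σ.length + 1))
  start_le : 0 ≤ coordAlong (heading σ) (p (σ.length + 1))

theorem IsAxisUnit.rot {d : ℤ × ℤ} (h : IsAxisUnit d) (c : Turn) : IsAxisUnit (c.rot d) := by
  rcases h with rfl | rfl | rfl | rfl <;> cases c <;> simp [Turn.rot, rotCCW, rotCW, IsAxisUnit]

theorem heading_append_singleton (σ : List Turn) (c : Turn) :
    heading (σ ++ [c]) = c.rot (heading σ) := by
  simp [heading]

theorem isAxisUnit_heading (σ : List Turn) : IsAxisUnit (heading σ) := by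
  induction σ using List.reverseRecOn with
  | nil => simp [heading, IsAxisUnit]
  | append_singleton σ c ih => rw [heading_append_singleton]; exact ih.rot c

theorem rot_rot_of_ne {c c' : Turn} (h : c ≠ c') (d : ℤ × ℤ) : c'.rot (c.rot d) = d := by
  cases c <;> cases c' <;> simp_all [Turn.rot, rotCCW, rotCW]

theorem heading_insert {c c' : Turn} (h : c ≠ c') (α β : List Turn) :
    heading (α ++ c :: c' :: β) = heading (α ++ β) := by
  simp [heading, rot_rot_of_ne h]

theorem heading_take_succ (σ : List Turn) (i : ℕ) (h : i < σ.length) :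
    heading (σ.take (i + 1)) = (σ[i]).rot (heading (σ.take i)) := by
  rw [← heading_append_singleton, List.take_append_getElem]

theorem excess_append (σ τ : List Turn) : excess (σ ++ τ) = excess σ + excess τ := by
  simp only [excess, List.count_append]; push_cast; ring

theorem excess_cons (c : Turn) (σ : List Turn) :
    excess (c :: σ) = (if c = Turn.L then 1 else -1) + excess σ := by
  cases c <;> simp [excess] <;> ring

theorem excess_insert {c c' : Turn} (h : c ≠ c') (α β : List Turn) :
    excess (α ++ c :: c' :: β) = excess (α ++ β) := by
  simp only [excess_append, excess_cons]
  cases c <;> cases c' <;> simp_all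

/-- The heading is determined by the excess modulo four. -/
theorem heading_excess (σ : List Turn) :
    (heading σ = (1, 0) ∧ excess σ % 4 = 0) ∨ (heading σ = (0, 1) ∧ excess σ % 4 = 1) ∨
    (heading σ = (-1, 0) ∧ excess σ % 4 = 2) ∨ (heading σ = (0, -1) ∧ excess σ % 4 = 3) := by
  induction σ using List.reverseRecOn with
  | nil => simp [heading, excess]
  | append_singleton σ c ih =>
    rw [heading_append_singleton, excess_append, excess_cons]
    rcases ih with ⟨h, e⟩ | ⟨h, e⟩ | ⟨h, e⟩ | ⟨h, e⟩ <;> rw [h] <;> cases c <;>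
      simp [Turn.rot, rotCCW, rotCW, excess] at * <;> omega

theorem IsStep.unitDir_eq {d a b : ℤ × ℤ} (hd : IsAxisUnit d) (h : IsStep d a b) :
    unitDir a b = d := by
  obtain ⟨t, ht, h1, h2⟩ := h
  rcases hd with rfl | rfl | rfl | rfl <;> simp [unitDir, h1, h2, ht]

theorem segSet_inter_eq_empty {a b c d : ℤ × ℤ} (h : Separated a b c d) :
    segSet a b ∩ segSet c d = ∅ := by
  ext q
  simp only [segSet, Set.mem_inter_iff, Set.mem_ofPred_eq, Set.mem_empty_iff_false, iff_false]
  unfold Separated at h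
  omega

theorem segSet_inter_of_turn {d a b e : ℤ × ℤ} {c : Turn} (hd : IsAxisUnit d)
    (h : IsStep d a b) (h' : IsStep (c.rot d) b e) : segSet a b ∩ segSet b e = {b} := by
  obtain ⟨t, ht, h1, h2⟩ := h
  obtain ⟨s, hs, h3, h4⟩ := h'
  ext q
  simp only [segSet, Set.mem_inter_iff, Set.mem_ofPred_eq, Set.mem_singleton_iff, Prod.ext_iff]
  rcases hd with rfl | rfl | rfl | rfl <;> cases c <;>
    simp [Turn.rot, rotCCW, rotCW] at h1 h2 h3 h4 <;> omega

/-- A realization gives a chain with the same points. -/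
def IsRealization.toChain {σ : List Turn} {p : ℕ → ℤ × ℤ} (h : IsRealization σ p) : Chain σ where
  pts := p
  start_eq := h.start_eq
  first_seg := by
    obtain ⟨t, ht, h1, h2⟩ := h.step 0 (Nat.zero_le _)
    refine ⟨t, ht, ?_⟩
    simp [heading, h.start_eq] at h1 h2
    exact Prod.ext h1 h2
  axis_parallel := by
    intro i hi
    obtain ⟨t, ht, h1, h2⟩ := h.step i hi
    rcases isAxisUnit_heading (σ.take i) with e | e | e | e <;> rw [e] at h1 h2 <;>
      simp at h1 h2 <;> omega
  turns := by
    intro i hi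
    rw [(h.step i hi.le).unitDir_eq (isAxisUnit_heading _),
      (h.step (i + 1) hi).unitDir_eq (isAxisUnit_heading _), heading_take_succ σ i hi]
    exact Turn.rot_eq_ite _ _
  simple_adj := by
    intro i hi
    have h' := h.step (i + 1) hi
    rw [heading_take_succ σ i hi] at h'
    exact segSet_inter_of_turn (isAxisUnit_heading _) (h.step i (by omega)) h'
  simple_nonadj := fun i j hij hj => segSet_inter_eq_empty (h.sep i j hij hj)

/-- Scale `p` by three and insert a unit jog with directions `u`, `e` into its segment `k`. -/
def jog (p : ℕ → ℤ × ℤ) (k : ℕ) (u e : ℤ × ℤ) (i : ℕ) : ℤ × ℤ :=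
  if i ≤ k then (3 * (p i).1, 3 * (p i).2)
  else if i = k + 1 then (3 * (p k).1 + u.1, 3 * (p k).2 + u.2)
  else if i = k + 2 then (3 * (p k).1 + u.1 + e.1, 3 * (p k).2 + u.2 + e.2)
  else if i = k + 3 then (3 * (p (k + 1)).1 + e.1, 3 * (p (k + 1)).2 + e.2)
  else (3 * (p (i - 2)).1, 3 * (p (i - 2)).2)

section Jog

variable (p : ℕ → ℤ × ℤ) (k : ℕ) (u e : ℤ × ℤ)

theorem jog_of_le {i : ℕ} (h : i ≤ k) : jog p k u e i = (3 * (p i).1, 3 * (p i).2) := by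
  simp [jog, h]

theorem jog_add_one : jog p k u e (k + 1) = (3 * (p k).1 + u.1, 3 * (p k).2 + u.2) := by
  simp [jog]

theorem jog_add_two :
    jog p k u e (k + 2) = (3 * (p k).1 + u.1 + e.1, 3 * (p k).2 + u.2 + e.2) := by
  simp [jog]

theorem jog_add_three :
    jog p k u e (k + 3) = (3 * (p (k + 1)).1 + e.1, 3 * (p (k + 1)).2 + e.2) := by
  simp [jog]

theorem jog_of_ge {i : ℕ} (h : k + 2 ≤ i) :
    jog p k u e (i + 2) = (3 * (p i).1, 3 * (p i).2) := by
  have h1 : ¬ i + 2 ≤ k := by omega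
  have h2 : i + 2 ≠ k + 1 := by omega
  have h3 : i ≠ k := by omega
  have h4 : i ≠ k + 1 := by omega
  simp [jog, h1, h2, h3, h4]

end Jog

/-- `x` lies at distance at most one from the bounding box of `3a` and `3b`. -/
def NearTriple (a b x : ℤ × ℤ) : Prop :=
  3 * min a.1 b.1 - 1 ≤ x.1 ∧ x.1 ≤ 3 * max a.1 b.1 + 1 ∧
  3 * min a.2 b.2 - 1 ≤ x.2 ∧ x.2 ≤ 3 * max a.2 b.2 + 1

theorem Separated.of_nearTriple {a b c d a' b' c' d' : ℤ × ℤ} (h : Separated a b c d)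
    (ha : NearTriple a b a') (hb : NearTriple a b b')
    (hc : NearTriple c d c') (hd : NearTriple c d d') : Separated a' b' c' d' := by
  unfold Separated NearTriple at *
  rcases h with h | h | h | h
  · exact Or.inl (by omega)
  · exact Or.inr (Or.inl (by omega))
  · exact Or.inr (Or.inr (Or.inl (by omega)))
  · exact Or.inr (Or.inr (Or.inr (by omega)))

/-- The segment of `p` near which segment `i` of the jogged chain runs. -/
def jogParent (k i : ℕ) : ℕ := if i ≤ k then i else if i ≤ k + 2 then k else i - 2

theorem jog_nearTriple (p : ℕ → ℤ × ℤ) (k : ℕ) {u : ℤ × ℤ} (hu : IsAxisUnit u) (c : Turn) (i : ℕ) :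
    NearTriple (p (jogParent k i)) (p (jogParent k i + 1)) (jog p k u (c.rot u) i) ∧
    NearTriple (p (jogParent k i)) (p (jogParent k i + 1)) (jog p k u (c.rot u) (i + 1)) := by
  have hcases : i < k ∨ i = k ∨ i = k + 1 ∨ i = k + 2 ∨ i = k + 3 ∨ ∃ m, i = (k + 2 + m) + 2 := by
    by_cases h : i < k + 4
    · omega
    · exact Or.inr (Or.inr (Or.inr (Or.inr (Or.inr ⟨i - k - 4, by omega⟩))))
  rcases hcases with h | rfl | rfl | rfl | rfl | ⟨m, rfl⟩
  · rw [jog_of_le _ _ _ _ h.le, jog_of_le (i := i + 1) _ _ _ _ h]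
    have : jogParent k i = i := by simp [jogParent, h.le]
    rw [this]; simp only [NearTriple]; omega
  · rw [jog_of_le _ _ _ _ le_rfl, jog_add_one]
    have : jogParent i i = i := by simp [jogParent]
    rw [this]; rcases hu with rfl | rfl | rfl | rfl <;> simp only [NearTriple] <;> omega
  · rw [jog_add_one, jog_add_two]
    have : jogParent k (k + 1) = k := by simp [jogParent]
    rw [this]
    rcases hu with rfl | rfl | rfl | rfl <;> cases c <;>
      simp only [NearTriple, Turn.rot, rotCCW, rotCW] <;> omega
  · rw [jog_add_two, jog_add_three]
    have : jogParent k (k + 2) = k := by simp [jogParent]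
    rw [this]
    rcases hu with rfl | rfl | rfl | rfl <;> cases c <;>
      simp only [NearTriple, Turn.rot, rotCCW, rotCW] <;> omega
  · rw [jog_add_three, show k + 3 + 1 = (k + 1 + 1) + 2 by omega,
      jog_of_ge _ _ _ _ (by omega)]
    have : jogParent k (k + 3) = k + 1 := by simp [jogParent]
    rw [this, show k + 1 + 1 = k + 2 from rfl]
    rcases hu with rfl | rfl | rfl | rfl <;> cases c <;>
      simp only [NearTriple, Turn.rot, rotCCW, rotCW] <;> omega
  · rw [jog_of_ge _ _ _ _ (by omega), show k + 2 + m + 2 + 1 = (k + 2 + m + 1) + 2 by omega,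
      jog_of_ge _ _ _ _ (by omega)]
    have : jogParent k (k + 2 + m + 2) = k + 2 + m := by
      unfold jogParent; split_ifs <;> omega
    rw [this]; simp only [NearTriple]; omega

theorem IsStep.triple {d a b : ℤ × ℤ} (h : IsStep d a b) :
    IsStep d (3 * a.1, 3 * a.2) (3 * b.1, 3 * b.2) := by
  obtain ⟨t, ht, h1, h2⟩ := h
  exact ⟨3 * t, by omega, by simp only [h1]; ring, by simp only [h2]; ring⟩

theorem separated_jog_self {u a b : ℤ × ℤ} {c : Turn} (hu : IsAxisUnit u) (h : IsStep u a b) :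
    Separated (3 * a.1, 3 * a.2) (3 * a.1 + u.1, 3 * a.2 + u.2)
      (3 * a.1 + u.1 + (c.rot u).1, 3 * a.2 + u.2 + (c.rot u).2)
      (3 * b.1 + (c.rot u).1, 3 * b.2 + (c.rot u).2) := by
  obtain ⟨t, ht, h1, h2⟩ := h
  rcases hu with rfl | rfl | rfl | rfl <;> cases c <;>
    simp only [Turn.rot, rotCCW, rotCW, Separated] at h1 h2 ⊢ <;> omega

theorem separated_jog_of_prev {d o a b : ℤ × ℤ} {c c₀ : Turn} (hd : IsAxisUnit d)
    (h₀ : IsStep d o a) (h : IsStep (c₀.rot d) a b) :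
    Separated (3 * o.1, 3 * o.2) (3 * a.1, 3 * a.2)
      (3 * a.1 + (c₀.rot d).1, 3 * a.2 + (c₀.rot d).2)
      (3 * a.1 + (c₀.rot d).1 + (c.rot (c₀.rot d)).1,
        3 * a.2 + (c₀.rot d).2 + (c.rot (c₀.rot d)).2) ∧
    Separated (3 * o.1, 3 * o.2) (3 * a.1, 3 * a.2)
      (3 * a.1 + (c₀.rot d).1 + (c.rot (c₀.rot d)).1,
        3 * a.2 + (c₀.rot d).2 + (c.rot (c₀.rot d)).2)
      (3 * b.1 + (c.rot (c₀.rot d)).1, 3 * b.2 + (c.rot (c₀.rot d)).2) := by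
  obtain ⟨s, hs, h3, h4⟩ := h₀
  obtain ⟨t, ht, h1, h2⟩ := h
  rcases hd with rfl | rfl | rfl | rfl <;> cases c₀ <;> cases c <;>
    simp only [Turn.rot, rotCCW, rotCW, Separated] at h1 h2 h3 h4 ⊢ <;>
    exact ⟨by omega, by omega⟩

theorem separated_jog_of_next {u a b z : ℤ × ℤ} {c c₁ : Turn} (hu : IsAxisUnit u)
    (h : IsStep u a b) (h₁ : IsStep (c₁.rot u) b z) :
    Separated (3 * a.1, 3 * a.2) (3 * a.1 + u.1, 3 * a.2 + u.2)
      (3 * b.1 + (c.rot u).1, 3 * b.2 + (c.rot u).2) (3 * z.1, 3 * z.2) ∧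
    Separated (3 * a.1 + u.1, 3 * a.2 + u.2)
      (3 * a.1 + u.1 + (c.rot u).1, 3 * a.2 + u.2 + (c.rot u).2)
      (3 * b.1 + (c.rot u).1, 3 * b.2 + (c.rot u).2) (3 * z.1, 3 * z.2) := by
  obtain ⟨s, hs, h3, h4⟩ := h₁
  obtain ⟨t, ht, h1, h2⟩ := h
  rcases hu with rfl | rfl | rfl | rfl <;> cases c₁ <;> cases c <;>
    simp only [Turn.rot, rotCCW, rotCW, Separated] at h1 h2 h3 h4 ⊢ <;>
    exact ⟨by omega, by omega⟩

section JogInsertion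

variable {α β : List Turn} {c c' : Turn} {p : ℕ → ℤ × ℤ}

theorem heading_take_insert_of_le {i : ℕ} (h : i ≤ α.length) :
    heading ((α ++ c :: c' :: β).take i) = heading ((α ++ β).take i) := by
  rw [List.take_append_of_le_length h, List.take_append_of_le_length h]

theorem heading_take_length : heading ((α ++ β).take α.length) = heading α := by simp

theorem heading_take_insert_add_one :
    heading ((α ++ c :: c' :: β).take (α.length + 1)) = c.rot (heading α) := by
  rw [List.take_length_add_append, ← heading_append_singleton]; simp

theorem heading_take_insert_of_ge (hc : c ≠ c') {i : ℕ} (h : α.length ≤ i) :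
    heading ((α ++ c :: c' :: β).take (i + 2)) = heading ((α ++ β).take i) := by
  obtain ⟨m, rfl⟩ := Nat.exists_eq_add_of_le h
  rw [add_assoc, List.take_length_add_append, List.take_length_add_append]
  exact heading_insert hc _ _

theorem heading_take_length_add_one (hβ : β ≠ []) :
    ∃ b : Turn, heading ((α ++ β).take (α.length + 1)) = b.rot (heading α) := by
  obtain ⟨b, γ, rfl⟩ := List.exists_cons_of_ne_nil hβ
  refine ⟨b, ?_⟩
  rw [List.take_length_add_append, ← heading_append_singleton]; simp

theorem IsRealization.jog_step (h : IsRealization (α ++ β) p) (hc : c ≠ c') (i : ℕ)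
    (hi : i ≤ (α ++ c :: c' :: β).length) :
    IsStep (heading ((α ++ c :: c' :: β).take i))
      (jog p α.length (heading α) (c.rot (heading α)) i)
      (jog p α.length (heading α) (c.rot (heading α)) (i + 1)) := by
  have hi' : i ≤ α.length + β.length + 2 := by simp at hi; omega
  have hlen : (α ++ β).length = α.length + β.length := List.length_append
  have hu := isAxisUnit_heading α
  have hk := h.step α.length (by omega)
  rw [heading_take_length] at hk
  have hcases : i < α.length ∨ i = α.length ∨ i = α.length + 1 ∨ i = α.length + 2 ∨
      i = α.length + 3 ∨ ∃ m, i = (α.length + 2 + m) + 2 := by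
    by_cases h : i < α.length + 4
    · omega
    · exact Or.inr (Or.inr (Or.inr (Or.inr (Or.inr ⟨i - α.length - 4, by omega⟩))))
  rcases hcases with hik | rfl | rfl | rfl | rfl | ⟨m, rfl⟩
  · rw [jog_of_le _ _ _ _ hik.le, jog_of_le _ _ _ _ hik, heading_take_insert_of_le hik.le]
    exact (h.step i (by omega)).triple
  · rw [jog_of_le _ _ _ _ le_rfl, jog_add_one, heading_take_insert_of_le le_rfl,
      heading_take_length]
    exact ⟨1, one_pos, by simp, by simp⟩
  · rw [jog_add_one, jog_add_two, heading_take_insert_add_one]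
    exact ⟨1, one_pos, by simp, by simp⟩
  · rw [jog_add_two, jog_add_three, heading_take_insert_of_ge hc le_rfl, heading_take_length]
    obtain ⟨t, ht, h1, h2⟩ := hk
    exact ⟨3 * t - 1, by omega, by simp only [h1]; ring, by simp only [h2]; ring⟩
  · have hβ : β ≠ [] := by rintro rfl; simp at hi'
    have hb : 1 ≤ β.length := List.length_pos_iff.mpr hβ
    rw [jog_add_three, show α.length + 3 + 1 = (α.length + 2) + 2 by omega,
      jog_of_ge _ _ _ _ le_rfl, show α.length + 3 = (α.length + 1) + 2 by omega,
      heading_take_insert_of_ge hc (by omega)]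
    obtain ⟨t, ht, h1, h2⟩ := h.step (α.length + 1) (by omega)
    obtain ⟨b, hb⟩ := heading_take_length_add_one (α := α) hβ
    rw [hb] at h1 h2 ⊢
    by_cases hbc : b = c
    · subst hbc
      exact ⟨3 * t - 1, by omega, by simp only [h1]; ring, by simp only [h2]; ring⟩
    · have hr : b.rot (heading α) = (-(c.rot (heading α)).1, -(c.rot (heading α)).2) := by
        cases b <;> cases c <;> simp_all [Turn.rot, rotCCW, rotCW]
      rw [hr] at h1 h2 ⊢
      exact ⟨3 * t + 1, by omega, by simp only [h1]; ring, by simp only [h2]; ring⟩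
  · rw [jog_of_ge _ _ _ _ (by omega),
      show α.length + 2 + m + 2 + 1 = (α.length + 2 + m + 1) + 2 by omega,
      jog_of_ge _ _ _ _ (by omega), heading_take_insert_of_ge hc (by omega)]
    exact (h.step _ (by omega)).triple

theorem IsRealization.jog_sep (h : IsRealization (α ++ β) p) (i j : ℕ) (hij : i + 1 < j)
    (hj : j ≤ (α ++ c :: c' :: β).length) :
    Separated (jog p α.length (heading α) (c.rot (heading α)) i)
      (jog p α.length (heading α) (c.rot (heading α)) (i + 1))
      (jog p α.length (heading α) (c.rot (heading α)) j)
      (jog p α.length (heading α) (c.rot (heading α)) (j + 1)) := by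
  have hj' : j ≤ α.length + β.length + 2 := by simp at hj; omega
  have hlen : (α ++ β).length = α.length + β.length := List.length_append
  have hu := isAxisUnit_heading α
  by_cases hpar : jogParent α.length i + 1 < jogParent α.length j
  · have hjl : jogParent α.length j ≤ (α ++ β).length := by
      unfold jogParent; split_ifs <;> omega
    obtain ⟨h1, h2⟩ := jog_nearTriple p α.length hu c i
    obtain ⟨h3, h4⟩ := jog_nearTriple p α.length hu c j
    exact (h.sep _ _ hpar hjl).of_nearTriple h1 h2 h3 h4
  have hk : IsStep (heading α) (p α.length) (p (α.length + 1)) := by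
    simpa using h.step α.length (by omega)
  have hcases : (i + 1 = α.length ∧ j = i + 2) ∨ (i + 1 = α.length ∧ j = i + 3) ∨
      (i = α.length ∧ j = α.length + 2) ∨ (i = α.length ∧ j = α.length + 3) ∨
      (i = α.length + 1 ∧ j = α.length + 3) := by
    unfold jogParent at hpar; split_ifs at hpar <;> omega
  have hprev : i + 1 = α.length → ∃ b : Turn, ∃ d, IsAxisUnit d ∧ heading α = b.rot d ∧
      IsStep d (p i) (p (i + 1)) := by
    intro hi
    have h' := h.step i (by omega)
    rw [List.take_append_of_le_length (by omega)] at h'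
    refine ⟨α[i], _, isAxisUnit_heading _, ?_, h'⟩
    rw [← heading_take_succ, hi, List.take_length]
  have hnext : j = α.length + 3 → ∃ b : Turn,
      IsStep (b.rot (heading α)) (p (α.length + 1)) (p (α.length + 2)) := by
    intro hjk
    have h' := h.step (α.length + 1) (by omega)
    have hβ : β ≠ [] := by rintro rfl; simp at hj'; omega
    obtain ⟨b, hb⟩ := heading_take_length_add_one (α := α) hβ
    exact ⟨b, hb ▸ h'⟩
  generalize heading α = u at *
  generalize α.length = k at *
  rcases hcases with ⟨rfl, rfl⟩ | ⟨rfl, rfl⟩ | ⟨rfl, rfl⟩ | ⟨rfl, rfl⟩ | ⟨rfl, rfl⟩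
  · obtain ⟨b, d, hd, rfl, hs⟩ := hprev rfl
    rw [jog_of_le _ _ _ _ (Nat.le_succ i), jog_of_le _ _ _ _ le_rfl,
      show i + 2 = i + 1 + 1 by omega, jog_add_one, jog_add_two]
    exact (separated_jog_of_prev hd hs hk).1
  · obtain ⟨b, d, hd, rfl, hs⟩ := hprev rfl
    rw [jog_of_le _ _ _ _ (Nat.le_succ i), jog_of_le _ _ _ _ le_rfl,
      show i + 3 = i + 1 + 2 by omega, jog_add_two, jog_add_three]
    exact (separated_jog_of_prev hd hs hk).2
  · rw [jog_of_le _ _ _ _ le_rfl, jog_add_one, jog_add_two, jog_add_three]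
    exact separated_jog_self hu hk
  · obtain ⟨b, hs⟩ := hnext rfl
    rw [jog_of_le _ _ _ _ le_rfl, jog_add_one, jog_add_three,
      show i + 3 + 1 = (i + 2) + 2 by omega, jog_of_ge _ _ _ _ le_rfl]
    exact (separated_jog_of_next hu hk hs).1
  · obtain ⟨b, hs⟩ := hnext rfl
    rw [jog_add_one, jog_add_two, jog_add_three,
      show k + 3 + 1 = (k + 2) + 2 by omega, jog_of_ge _ _ _ _ le_rfl]
    exact (separated_jog_of_next hu hk hs).2

theorem IsRealization.jog (h : IsRealization (α ++ β) p) (hc : c ≠ c') :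
    IsRealization (α ++ c :: c' :: β) (jog p α.length (heading α) (c.rot (heading α))) where
  start_eq := by simp [jog_of_le, h.start_eq]
  step := h.jog_step hc
  sep := h.jog_sep

theorem IsExtremal.jog (h : IsExtremal (α ++ β) p) (hc : c ≠ c') :
    IsExtremal (α ++ c :: c' :: β) (jog p α.length (heading α) (c.rot (heading α))) := by
  have hlen : (α ++ β).length = α.length + β.length := List.length_append
  have hlen' : (α ++ c :: c' :: β).length = α.length + β.length + 2 := by simp; omega
  have hu := isAxisUnit_heading α
  have hd := isAxisUnit_heading (α ++ β)
  have hpos := h.inner_pos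
  have hlt := h.inner_lt
  have hend := h.end_nonneg
  have hle := h.start_le
  have hstart := h.start_eq
  have hk : IsStep (heading α) (p α.length) (p (α.length + 1)) := by
    simpa using h.step α.length (by omega)
  have hα : α.length = 0 → heading α = (1, 0) := by
    intro h0; rw [List.length_eq_zero_iff.mp h0]; rfl
  have hβ : β.length = 0 → heading (α ++ β) = heading α := by
    intro h0; rw [List.length_eq_zero_iff.mp h0, List.append_nil]
  have hj := h.toIsRealization.jog hc
  rw [hlen] at hpos hlt hend hle
  generalize he : heading (α ++ β) = d at *
  have hvertex : ∀ i, 1 ≤ i → i ≤ α.length + β.length + 2 →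
      (1 ≤ α.length ∧ (i = α.length + 1 ∨ i = α.length + 2)) ∨
      (α.length = 0 ∧ (i = α.length + 1 ∨ i = α.length + 2)) ∨
      (1 ≤ β.length ∧ i = α.length + 3) ∨ i ≤ α.length ∨
      ∃ m, α.length + 2 ≤ m ∧ i = m + 2 := by
    intro i h1 h2
    by_cases hi : α.length + 4 ≤ i
    · exact Or.inr (Or.inr (Or.inr (Or.inr ⟨i - 2, by omega, by omega⟩)))
    · omega
  have hlast : (β.length = 0 ∧ _root_.jog p α.length (heading α) (c.rot (heading α))
        (α.length + β.length + 2 + 1) = (3 * (p (α.length + β.length + 1)).1 + (c.rot (heading α)).1,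
          3 * (p (α.length + β.length + 1)).2 + (c.rot (heading α)).2)) ∨
      (1 ≤ β.length ∧ _root_.jog p α.length (heading α) (c.rot (heading α))
        (α.length + β.length + 2 + 1) = (3 * (p (α.length + β.length + 1)).1,
          3 * (p (α.length + β.length + 1)).2)) := by
    rcases Nat.eq_zero_or_pos β.length with h0 | h0
    · exact Or.inl ⟨h0, by rw [h0]; exact jog_add_three _ _ _ _⟩
    · exact Or.inr ⟨h0, jog_of_ge (i := α.length + β.length + 1) _ _ _ _ (by omega)⟩
  have hstart' : α.length = 0 → p α.length = (0, 0) := fun h0 => by rw [h0, hstart]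
  have hend3 : coordAlong d (_root_.jog p α.length (heading α) (c.rot (heading α))
      (α.length + β.length + 2 + 1)) = 3 * coordAlong d (p (α.length + β.length + 1)) := by
    rcases hlast with ⟨h0, h1⟩ | ⟨-, h1⟩ <;> rw [h1]
    · rw [hβ h0]
      rcases hu with e | e | e | e <;> rw [e] <;> cases c <;>
        simp [coordAlong, Turn.rot, rotCCW, rotCW]
    · simp only [coordAlong]; ring
  refine { hj with inner_pos := ?_, end_nonneg := ?_, inner_lt := ?_, start_le := ?_ }
  · intro i h1 hi
    rw [hlen'] at hi
    rcases hvertex i h1 hi with ⟨h0, rfl | rfl⟩ | ⟨h0, rfl | rfl⟩ | ⟨h0, rfl⟩ | hi | ⟨m, hm, rfl⟩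
    · have := hpos α.length h0 (by omega)
      rw [jog_add_one]
      rcases hu with e | e | e | e <;> simp only [e] <;> omega
    · have := hpos α.length h0 (by omega)
      rw [jog_add_two]
      rcases hu with e | e | e | e <;> cases c <;> simp only [e, Turn.rot, rotCCW, rotCW] <;> omega
    · rw [jog_add_one, hstart' h0, hα h0]; simp
    · rw [jog_add_two, hstart' h0, hα h0]; cases c <;> simp [Turn.rot, rotCCW, rotCW]
    · have := hpos (α.length + 1) (by omega) (by omega)
      rw [jog_add_three]
      rcases hu with e | e | e | e <;> cases c <;> simp only [e, Turn.rot, rotCCW, rotCW] <;> omega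
    · have := hpos i h1 (by omega)
      rw [jog_of_le _ _ _ _ hi]; simp only; omega
    · have := hpos m (by omega) (by omega)
      rw [jog_of_ge _ _ _ _ hm]; simp only; omega
  · rw [hlen']
    rcases hlast with ⟨h0, h1⟩ | ⟨-, h1⟩ <;> rw [h1]
    · obtain ⟨t, ht, h2, -⟩ := hk
      rw [h0, add_zero] at hend ⊢
      rcases Nat.eq_zero_or_pos α.length with hz | hz
      · rw [hα hz]; cases c <;> simpa [Turn.rot, rotCCW, rotCW] using hend
      · have := hpos α.length hz (by omega)
        rcases hu with e | e | e | e <;> cases c <;>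
          simp only [e, Turn.rot, rotCCW, rotCW] at h2 ⊢ <;> omega
    · simp only; omega
  · intro i h1 hi
    rw [hlen'] at hi ⊢
    rw [heading_insert hc, he, hend3]
    rcases hvertex i h1 hi with ⟨h0, h2⟩ | ⟨h0, h2⟩ | ⟨h0, rfl⟩ | hi | ⟨m, hm, rfl⟩
    · have := hlt α.length h0 (by omega)
      rcases h2 with rfl | rfl
      · rw [jog_add_one]
        rcases hd with rfl | rfl | rfl | rfl <;> rcases hu with e | e | e | e <;>
          simp only [coordAlong, e] at this ⊢ <;> omega
      · rw [jog_add_two]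
        rcases hd with rfl | rfl | rfl | rfl <;> rcases hu with e | e | e | e <;> cases c <;>
          simp only [coordAlong, e, Turn.rot, rotCCW, rotCW] at this ⊢ <;> omega
    · obtain ⟨t, ht, h3, h4⟩ := hk
      rw [hstart' h0, hα h0] at h3 h4
      have hx : coordAlong d (p (α.length + 1)) ≤ coordAlong d (p (α.length + β.length + 1)) ∧
          (β.length = 0 → d = (1, 0)) ∧
          (1 ≤ β.length → coordAlong d (p (α.length + 1)) <
            coordAlong d (p (α.length + β.length + 1))) := by
        rcases Nat.eq_zero_or_pos β.length with hz | hz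
        · refine ⟨by rw [hz, add_zero], fun _ => by rw [hβ hz, hα h0], by omega⟩
        · have := hlt (α.length + 1) (by omega) (by omega)
          exact ⟨this.le, by omega, fun _ => this⟩
      generalize β.length = b at *
      rcases h2 with rfl | rfl
      · rw [jog_add_one, hstart' h0, hα h0]
        rcases hd with rfl | rfl | rfl | rfl <;> simp [coordAlong] at hx hle h3 h4 ⊢ <;> omega
      · rw [jog_add_two, hstart' h0, hα h0]
        rcases hd with rfl | rfl | rfl | rfl <;> cases c <;>
          simp [coordAlong, Turn.rot, rotCCW, rotCW] at hx hle h3 h4 ⊢ <;> omega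
    · have := hlt (α.length + 1) (by omega) (by omega)
      rw [jog_add_three]
      rcases hd with rfl | rfl | rfl | rfl <;> rcases hu with e | e | e | e <;> cases c <;>
        simp only [coordAlong, e, Turn.rot, rotCCW, rotCW] at this ⊢ <;> omega
    · have := hlt i h1 (by omega)
      rw [jog_of_le _ _ _ _ hi]
      simp only [coordAlong] at this ⊢; linarith
    · have := hlt m (by omega) (by omega)
      rw [jog_of_ge _ _ _ _ hm]
      simp only [coordAlong] at this ⊢; linarith
  · rw [hlen', heading_insert hc, he, hend3]; omega

end JogInsertion

theorem exists_append_or_eq_replicate (σ : List Turn) :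
    (∃ α β c c', c ≠ c' ∧ σ = α ++ c :: c' :: β) ∨ ∃ n c, σ = List.replicate n c := by
  induction σ with
  | nil => exact Or.inr ⟨0, Turn.L, rfl⟩
  | cons a σ ih =>
    rcases ih with ⟨α, β, c, c', h, rfl⟩ | ⟨n, c, rfl⟩
    · exact Or.inl ⟨a :: α, β, c, c', h, rfl⟩
    · rcases n with _ | n
      · exact Or.inr ⟨1, a, rfl⟩
      · by_cases h : a = c
        · exact Or.inr ⟨n + 2, a, by rw [h]; rfl⟩
        · exact Or.inl ⟨[], List.replicate n c, a, c, h, rfl⟩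

/-- Vertices of the chain with up to two equal turns. -/
def hook (s : ℤ) : ℕ → ℤ × ℤ
  | 0 => (0, 0)
  | 1 => (1, 0)
  | 2 => (1, s)
  | _ => (0, s)

theorem isExtremal_replicate (n : ℕ) (hn : n ≤ 2) (c : Turn) :
    IsExtremal (List.replicate n c) (hook (c.rot (1, 0)).2) where
  start_eq := rfl
  step i hi := by
    refine ⟨1, one_pos, ?_⟩
    rw [List.length_replicate] at hi
    interval_cases n <;> interval_cases i <;> cases c <;>
      simp [hook, heading, Turn.rot, rotCCW, rotCW]
  sep i j hij hj := by
    rw [List.length_replicate] at hj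
    obtain ⟨rfl, rfl⟩ : i = 0 ∧ j = 2 := by omega
    cases c <;> simp [hook, Separated, Turn.rot, rotCCW, rotCW]
  inner_pos i h1 hi := by
    rw [List.length_replicate] at hi
    interval_cases n <;> interval_cases i <;> simp [hook]
  end_nonneg := by
    interval_cases n <;> simp [hook]
  inner_lt i h1 hi := by
    rw [List.length_replicate] at hi
    interval_cases n <;> interval_cases i <;> cases c <;>
      simp [hook, heading, coordAlong, Turn.rot, rotCCW, rotCW]
  start_le := by
    interval_cases n <;> cases c <;> simp [hook, heading, coordAlong, Turn.rot, rotCCW, rotCW]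

theorem excess_replicate (n : ℕ) (c : Turn) : |excess (List.replicate n c)| = n := by
  cases c <;> simp [excess, List.count_replicate]

theorem exists_isExtremal (σ : List Turn) (h : |excess σ| ≤ 2) : ∃ p, IsExtremal σ p := by
  induction hn : σ.length using Nat.strong_induction_on generalizing σ with
  | _ n ih =>
    rcases exists_append_or_eq_replicate σ with ⟨α, β, c, c', hc, rfl⟩ | ⟨m, c, rfl⟩
    · rw [excess_insert hc] at h
      obtain ⟨p, hp⟩ := ih (α ++ β).length (by simp at hn ⊢; omega) _ h rfl
      exact ⟨_, hp.jog hc⟩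
    · rw [excess_replicate] at h
      exact ⟨_, isExtremal_replicate m (by exact_mod_cast h) c⟩

theorem IsExtremal.onBBoxBoundary_start {σ : List Turn} {p : ℕ → ℤ × ℤ} (h : IsExtremal σ p) :
    OnBBoxBoundary σ h.toChain (h.toChain.pts 0) := by
  refine Or.inl fun i hi => ?_
  change (p 0).1 ≤ (p i).1
  rw [h.start_eq]
  rcases Nat.eq_zero_or_pos i with rfl | h0
  · rw [h.start_eq]
  · rcases hi.lt_or_eq with h1 | rfl
    · exact (h.inner_pos i h0 (by omega)).le
    · exact h.end_nonneg

theorem IsExtremal.coordAlong_le_end {σ : List Turn} {p : ℕ → ℤ × ℤ} (h : IsExtremal σ p) (i : ℕ)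
    (hi : i ≤ σ.length + 1) :
    coordAlong (heading σ) (p i) ≤ coordAlong (heading σ) (p (σ.length + 1)) := by
  rcases Nat.eq_zero_or_pos i with rfl | h0
  · rw [h.start_eq]; simpa [coordAlong] using h.start_le
  · rcases hi.lt_or_eq with h1 | rfl
    · exact (h.inner_lt i h0 (by omega)).le
    · exact le_rfl

theorem IsExtremal.onBBoxBoundary_end {σ : List Turn} {p : ℕ → ℤ × ℤ} (h : IsExtremal σ p) :
    OnBBoxBoundary σ h.toChain (h.toChain.pts (σ.length + 1)) := by
  change (∀ i ≤ _, (p _).1 ≤ (p i).1) ∨ (∀ i ≤ _, (p i).1 ≤ (p _).1) ∨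
    (∀ i ≤ _, (p _).2 ≤ (p i).2) ∨ (∀ i ≤ _, (p i).2 ≤ (p _).2)
  have key := h.coordAlong_le_end
  rcases isAxisUnit_heading σ with e | e | e | e <;> simp [e, coordAlong] at key
  · exact Or.inr (Or.inl key)
  · exact Or.inr (Or.inr (Or.inr key))
  · exact Or.inl key
  · exact Or.inr (Or.inr (Or.inl key))

theorem IsExtremal.coordAlong_lt_end {τ : List Turn} {p : ℕ → ℤ × ℤ} (h : IsExtremal τ p)
    (hτ : excess τ % 2 = 1) (i : ℕ) (hi : i ≤ τ.length) :
    coordAlong (heading τ) (p i) < coordAlong (heading τ) (p (τ.length + 1)) := by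
  rcases Nat.eq_zero_or_pos i with rfl | h0
  · have hlen : 1 ≤ τ.length := by
      rcases τ with _ | _
      · simp [excess] at hτ
      · simp
    obtain ⟨t, -, -, h2⟩ := h.step 0 (Nat.zero_le _)
    have h1 := h.inner_lt 1 le_rfl hlen
    have e0 : heading (τ.take 0) = (1, 0) := rfl
    rw [e0] at h2
    rcases heading_excess τ with ⟨e, h4⟩ | ⟨e, h4⟩ | ⟨e, h4⟩ | ⟨e, h4⟩ <;> rw [e] at h1 ⊢ <;>
      simp [coordAlong] at h1 h2 ⊢ <;> omega
  · exact h.inner_lt i h0 hi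

/-- Append a unit segment in direction `e` at the end of a chain with `n` turns. -/
def extend (p : ℕ → ℤ × ℤ) (n : ℕ) (e : ℤ × ℤ) (i : ℕ) : ℤ × ℤ :=
  if i ≤ n + 1 then p i else ((p (n + 1)).1 + e.1, (p (n + 1)).2 + e.2)

theorem extend_of_le (p : ℕ → ℤ × ℤ) {n i : ℕ} (e : ℤ × ℤ) (h : i ≤ n + 1) :
    extend p n e i = p i := by
  simp [extend, h]

theorem extend_last (p : ℕ → ℤ × ℤ) (n : ℕ) (e : ℤ × ℤ) :
    extend p n e (n + 2) = ((p (n + 1)).1 + e.1, (p (n + 1)).2 + e.2) := by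
  simp [extend]

theorem separated_of_coordAlong_lt {d a b z : ℤ × ℤ} {c : Turn} (hd : IsAxisUnit d)
    (ha : coordAlong d a < coordAlong d z) (hb : coordAlong d b < coordAlong d z) :
    Separated a b z (z.1 + (c.rot d).1, z.2 + (c.rot d).2) := by
  rcases hd with rfl | rfl | rfl | rfl <;> cases c <;>
    simp [coordAlong, Turn.rot, rotCCW, rotCW, Separated] at * <;> omega

theorem IsExtremal.extend {τ : List Turn} {p : ℕ → ℤ × ℤ} (h : IsExtremal τ p)
    (hτ : excess τ % 2 = 1) (c : Turn) :
    IsRealization (τ ++ [c]) (extend p τ.length (c.rot (heading τ))) where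
  start_eq := by rw [extend_of_le _ _ (Nat.zero_le _), h.start_eq]
  step i hi := by
    have hi' : i ≤ τ.length + 1 := by simpa using hi
    rcases hi'.lt_or_eq with h1 | rfl
    · rw [extend_of_le _ _ hi', extend_of_le _ _ h1, List.take_append_of_le_length (by omega)]
      exact h.step i (by omega)
    · rw [extend_of_le _ _ le_rfl, extend_last, List.take_of_length_le (by simp),
        heading_append_singleton]
      exact ⟨1, one_pos, by simp, by simp⟩
  sep i j hij hj := by
    have hj' : j ≤ τ.length + 1 := by simpa using hj
    rw [extend_of_le (i := i) _ _ (by omega), extend_of_le (i := i + 1) _ _ (by omega),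
      extend_of_le (i := j) _ _ hj']
    rcases hj'.lt_or_eq with h1 | rfl
    · rw [extend_of_le _ _ h1]
      exact h.sep i j hij (by omega)
    · rw [extend_last]
      exact separated_of_coordAlong_lt (isAxisUnit_heading τ)
        (h.coordAlong_lt_end hτ i (by omega)) (h.coordAlong_lt_end hτ (i + 1) (by omega))

theorem IsExtremal.lastSegOnSide_extend {τ : List Turn} {p : ℕ → ℤ × ℤ} (h : IsExtremal τ p)
    (hτ : excess τ % 2 = 1) (c : Turn) : LastSegOnSide (τ ++ [c]) (h.extend hτ c).toChain := by
  have key : ∀ i ≤ τ.length + 2,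
      coordAlong (heading τ) (_root_.extend p τ.length (c.rot (heading τ)) i) ≤
        coordAlong (heading τ) (p (τ.length + 1)) := by
    intro i hi
    rcases hi.lt_or_eq with h1 | rfl
    · rw [extend_of_le _ _ (by omega)]
      exact h.coordAlong_le_end i (by omega)
    · rw [extend_last]
      rcases isAxisUnit_heading τ with e | e | e | e <;> rw [e] <;> cases c <;>
        simp [coordAlong, Turn.rot, rotCCW, rotCW]
  have hlen : (τ ++ [c]).length = τ.length + 1 := by simp
  simp only [LastSegOnSide, IsRealization.toChain, hlen]
  rw [extend_last, extend_of_le _ _ le_rfl]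
  rcases isAxisUnit_heading τ with e | e | e | e <;> rw [e] at key ⊢
  · exact Or.inr (Or.inl ⟨by cases c <;> simp [Turn.rot, rotCCW, rotCW],
      by simpa [coordAlong] using key⟩)
  · exact Or.inr (Or.inr (Or.inr ⟨by cases c <;> simp [Turn.rot, rotCCW, rotCW],
      by simpa [coordAlong] using key⟩))
  · exact Or.inl ⟨by cases c <;> simp [Turn.rot, rotCCW, rotCW],
      by simpa [coordAlong] using key⟩
  · exact Or.inr (Or.inr (Or.inl ⟨by cases c <;> simp [Turn.rot, rotCCW, rotCW],
      by simpa [coordAlong] using key⟩))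

theorem isRealization_nil : IsRealization [] (hook 1) :=
  (isExtremal_replicate 0 (by omega) Turn.L).toIsRealization

theorem lastSegOnSide_nil : LastSegOnSide [] isRealization_nil.toChain := by
  refine Or.inr (Or.inr (Or.inl ⟨rfl, fun i hi => ?_⟩))
  change (hook 1 0).2 ≤ (hook 1 i).2
  have hi' : i ≤ 1 := hi
  interval_cases i <;> exact le_rfl

/-- **Realizations with endpoints on the bounding box.** Every turn sequence with
`l - r ∈ {0, 1, -1, 2, -2}` has a realization with both the origin and the endpoint
on the boundary of its smallest bounding box; moreover if `l - r = 0` there is a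
realization whose last segment is contained in one side of its bounding box. -/
theorem small_excess_bbox (σ : List Turn) :
    (excess σ = 0 ∨ excess σ = 1 ∨ excess σ = -1 ∨ excess σ = 2 ∨ excess σ = -2 →
      ∃ C : Chain σ, OnBBoxBoundary σ C (C.pts 0) ∧
        OnBBoxBoundary σ C (C.pts (σ.length + 1))) ∧
    (excess σ = 0 → ∃ C : Chain σ, LastSegOnSide σ C) := by
  refine ⟨fun h => ?_, fun h => ?_⟩
  · obtain ⟨p, hp⟩ := exists_isExtremal σ (by rcases h with h | h | h | h | h <;> rw [h] <;> decide)
    exact ⟨hp.toChain, hp.onBBoxBoundary_start, hp.onBBoxBoundary_end⟩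
  · rcases List.eq_nil_or_concat σ with rfl | ⟨τ, c, rfl⟩
    · exact ⟨_, lastSegOnSide_nil⟩
    · rw [List.concat_eq_append, excess_append, excess_cons] at h
      have hτ : excess τ = 1 ∨ excess τ = -1 := by
        cases c <;> simp [excess] at h ⊢ <;> omega
      obtain ⟨p, hp⟩ := exists_isExtremal τ (by rcases hτ with h | h <;> rw [h] <;> decide)
      rw [List.concat_eq_append]
      exact ⟨_, hp.lastSegOnSide_extend (by omega) c⟩
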